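/- Let F be a γ-pliable set family on a finite set V, let 𝒞 be the family of F-cores, and let I be an inclusion-minimal cover of F such that every edge of I covers some F-core. Then ∑_{C ∈ 𝒞} d_I(C) ≤ 5·(2|𝒞| − 1). -/

import Mathlib

open scoped Classical

namespace SFEC

variable {V : Type*}

/-- An edge (an unordered pair of distinct elements) `e` covers a set `S`
if exactly one endpoint of `e` lies in `S`. -/
def Covers (e : Sym2 V) (S : Set V) : Prop :=
  ∃ u v : V, e = s(u, v) ∧ u ∈ S ∧ v ∉ S

/-- `delta I S` is the set of edges of `I` with exactly one endpoint in `S`. -/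
noncomputable def delta (I : Finset (Sym2 V)) (S : Set V) : Finset (Sym2 V) :=
  I.filter (fun e => Covers e S)

/-- `d I S = |delta I S|`. -/
noncomputable def d (I : Finset (Sym2 V)) (S : Set V) : ℕ := (delta I S).card

/-- A set family on `V`: a collection of subsets with `∅ ∉ F` and `V ∉ F`. -/
def IsSetFamily (F : Set (Set V)) : Prop := ∅ ∉ F ∧ Set.univ ∉ F

/-- `I` covers the family `F` if it covers every member of `F`. -/
def CoversFam (I : Finset (Sym2 V)) (F : Set (Set V)) : Prop := ∀ S ∈ F, 1 ≤ d I S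

/-- `I` is an inclusion-minimal cover of `F`. -/
def MinimalCover (I : Finset (Sym2 V)) (F : Set (Set V)) : Prop :=
  CoversFam I F ∧ ∀ J : Finset (Sym2 V), J ⊂ I → ¬ CoversFam J F

/-- At least two of the four statements hold. -/
def AtLeastTwo (p q r s : Prop) : Prop :=
  (p ∧ q) ∨ (p ∧ r) ∨ (p ∧ s) ∨ (q ∧ r) ∨ (q ∧ s) ∨ (r ∧ s)

/-- A family is pliable if for all `A, B ∈ F` at least two of the four sets
`A ∩ B, A ∪ B, A \ B, B \ A` belong to `F`. -/
def Pliable (F : Set (Set V)) : Prop :=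
  ∀ A ∈ F, ∀ B ∈ F, AtLeastTwo (A ∩ B ∈ F) (A ∪ B ∈ F) (A \ B ∈ F) (B \ A ∈ F)

/-- The residual family `F^I`: the members of `F` covered by no edge of `I`. -/
def Residual (F : Set (Set V)) (I : Finset (Sym2 V)) : Set (Set V) := {S ∈ F | d I S = 0}

/-- `A` and `B` cross if `A ∩ B`, `A \ B`, `B \ A` and `V \ (A ∪ B)` are all nonempty. -/
def Crosses (A B : Set V) : Prop :=
  (A ∩ B).Nonempty ∧ (A \ B).Nonempty ∧ (B \ A).Nonempty ∧ ((A ∪ B)ᶜ : Set V).Nonempty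

/-- An `F`-core: an inclusion-minimal member of `F`. -/
def Core (F : Set (Set V)) (C : Set V) : Prop := C ∈ F ∧ ∀ A ∈ F, A ⊆ C → A = C

/-- Property (γ). -/
def PropertyGamma (F : Set (Set V)) : Prop :=
  ∀ (J : Finset (Sym2 V)) (S₁ S₂ C : Set V),
    S₁ ∈ Residual F J → S₂ ∈ Residual F J → S₁ ⊂ S₂ →
    Core (Residual F J) C → Crosses C S₁ → Crosses C S₂ →
    S₂ \ (S₁ ∪ C) = ∅ ∨ S₂ \ (S₁ ∪ C) ∈ Residual F J

/-- `F` is γ-pliable: pliable and satisfying Property (γ). -/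
def GammaPliable (F : Set (Set V)) : Prop := Pliable F ∧ PropertyGamma F

/-- `S` is a witness set for the edge `e ∈ I` if `δ_I(S) = {e}`. -/
def WitnessSet (F : Set (Set V)) (I : Finset (Sym2 V)) (S : Set V) (e : Sym2 V) : Prop :=
  S ∈ F ∧ delta I S = {e}

/-- `L ⊆ F` is a witness family for `I`: `|L| = |I|` and each `e ∈ I` has a witness set in `L`. -/
def WitnessFamily (F : Set (Set V)) (I : Finset (Sym2 V)) (L : Finset (Set V)) : Prop :=
  ↑L ⊆ F ∧ L.card = I.card ∧ ∀ e ∈ I, ∃ S ∈ L, WitnessSet F I S e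

/-- A family is laminar if any two members are disjoint or one contains the other. -/
def Laminar (L : Finset (Set V)) : Prop :=
  ∀ A ∈ L, ∀ B ∈ L, A ⊆ B ∨ B ⊆ A ∨ Disjoint A B

/-- `S ∈ L` owns `C` if `S` is the inclusion-minimal member of `L` containing `C`. -/
def Owns (L : Finset (Set V)) (S C : Set V) : Prop :=
  S ∈ L ∧ C ⊆ S ∧ ∀ T ∈ L, C ⊆ T → S ⊆ T

/-- `S ∈ L` is hollow if it owns no `F`-core. -/
def Hollow (F : Set (Set V)) (L : Finset (Set V)) (S : Set V) : Prop :=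
  S ∈ L ∧ ∀ C : Set V, Core F C → ¬ Owns L S C

/-- `A` is the unique child of `S` in `L`: the unique maximal member of `L`
properly contained in `S`. -/
def UniqueChild (L : Finset (Set V)) (A S : Set V) : Prop :=
  A ∈ L ∧ A ⊂ S ∧ ∀ B ∈ L, B ⊂ S → B ⊆ A

/-- `(S 0, S 1, …, S ℓ)` is a hollow chain in `L`. -/
def HollowChain (F : Set (Set V)) (L : Finset (Set V)) (S : ℕ → Set V) (ℓ : ℕ) : Prop :=
  (∀ i ≤ ℓ, S i ∈ L) ∧
  (∀ i, 1 ≤ i → i ≤ ℓ → Hollow F L (S i)) ∧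
  S ℓ ≠ Set.univ ∧
  (∀ i, 1 ≤ i → i ≤ ℓ → UniqueChild L (S (i - 1)) (S i))

/-- `U`: the union of all `F`-cores. -/
def coreUnion (F : Set (Set V)) : Set V := ⋃₀ {C | Core F C}

/-- `F` is uncrossable. -/
def Uncrossable (F : Set (Set V)) : Prop :=
  ∀ A ∈ F, ∀ B ∈ F, (A ∩ B ∈ F ∧ A ∪ B ∈ F) ∨ (A \ B ∈ F ∧ B \ A ∈ F)

/-- `F` is semi-uncrossable. -/
def SemiUncrossable (F : Set (Set V)) : Prop :=
  ∀ A ∈ F, ∀ B ∈ F,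
    (A ∩ B ∈ F ∧ (A ∪ B ∈ F ∨ A \ B ∈ F ∨ B \ A ∈ F)) ∨ (A \ B ∈ F ∧ B \ A ∈ F)

end SFEC

open SFEC

namespace SFEC

variable {V : Type*}

lemma covers_mk {x y : V} {S : Set V} :
    Covers s(x, y) S ↔ (x ∈ S ∧ y ∉ S) ∨ (y ∈ S ∧ x ∉ S) := by
  constructor
  · rintro ⟨u, v, h, hu, hv⟩
    rcases Sym2.eq_iff.1 h with ⟨rfl, rfl⟩ | ⟨rfl, rfl⟩
    · exact Or.inl ⟨hu, hv⟩
    · exact Or.inr ⟨hu, hv⟩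
  · rintro (⟨h₁, h₂⟩ | ⟨h₁, h₂⟩)
    · exact ⟨x, y, rfl, h₁, h₂⟩
    · exact ⟨y, x, Sym2.eq_swap, h₁, h₂⟩

lemma delta_eq_singleton {I : Finset (Sym2 V)} {S : Set V} {e : Sym2 V} :
    delta I S = {e} ↔ e ∈ I ∧ Covers e S ∧ ∀ f ∈ I, Covers f S → f = e := by
  rw [Finset.eq_singleton_iff_unique_mem]
  simp only [delta, Finset.mem_filter]
  tauto

lemma CoversFam.exists_covers {I : Finset (Sym2 V)} {F : Set (Set V)} (h : CoversFam I F)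
    {S : Set V} (hS : S ∈ F) : ∃ e ∈ I, Covers e S := by
  obtain ⟨e, he⟩ := Finset.card_pos.1 (h S hS)
  exact ⟨e, (Finset.mem_filter.1 he).1, (Finset.mem_filter.1 he).2⟩

lemma MinimalCover.exists_witnessSet {I : Finset (Sym2 V)} {F : Set (Set V)}
    (h : MinimalCover I F) {e : Sym2 V} (he : e ∈ I) : ∃ S, WitnessSet F I S e := by
  have h1 := h.2 (I.erase e) (Finset.erase_ssubset he)
  simp only [CoversFam, not_forall] at h1
  obtain ⟨S, hS, hd⟩ := h1
  have h0 : ∀ f ∈ I, Covers f S → f = e := by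
    intro f hf hfS
    by_contra hne
    exact hd (Finset.card_pos.2 ⟨f, Finset.mem_filter.2 ⟨Finset.mem_erase.2 ⟨hne, hf⟩, hfS⟩⟩)
  obtain ⟨g, hg, hgS⟩ := h.1.exists_covers hS
  have hge := h0 g hg hgS
  subst hge
  exact ⟨S, hS, delta_eq_singleton.2 ⟨hg, hgS, h0⟩⟩

/-- `A` and `B` are nested or disjoint. -/
def Nested (A B : Set V) : Prop := A ⊆ B ∨ B ⊆ A ∨ Disjoint A B

lemma Nested.symm {A B : Set V} (h : Nested A B) : Nested B A := by
  rcases h with h | h | h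
  · exact Or.inr (Or.inl h)
  · exact Or.inl h
  · exact Or.inr (Or.inr h.symm)

lemma Nested.corners {A B T : Set V} (hA : Nested A T) (hB : Nested B T)
    (hAB : ¬ Nested A B) :
    Nested (A ∩ B) T ∧ Nested (A ∪ B) T ∧ Nested (A \ B) T ∧ Nested (B \ A) T := by
  simp only [Nested, Set.subset_def, Set.disjoint_left, Set.mem_inter_iff, Set.mem_union,
    Set.mem_sdiff] at *
  grind

/-- If no corner of the pair `A`, `B` is a witness set for `f`, then both corners met by `e`
belong to the family, and the one avoiding `f` is a witness set for `e`. -/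
lemma exists_witness_uncrossed {F : Set (Set V)} (hF : Pliable F) {I : Finset (Sym2 V)}
    (hI : CoversFam I F) {e : Sym2 V} {b b' : V} {A B : Set V}
    (hA : WitnessSet F I A e) (hB : WitnessSet F I B s(b, b')) (hb : b ∈ B) (hb' : b' ∉ B)
    (hne : e ≠ s(b, b'))
    (hmin : ∀ X, X = A ∩ B ∨ X = A ∪ B ∨ X = A \ B ∨ X = B \ A →
      ¬ WitnessSet F I X s(b, b')) :
    WitnessSet F I (if b ∈ A then A ∪ B else A \ B) e ∨
      WitnessSet F I (if b ∈ A then B \ A else A ∩ B) e := by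
  obtain ⟨hAF, hA⟩ := hA
  obtain ⟨hBF, hB⟩ := hB
  obtain ⟨heI, heA, hA⟩ := delta_eq_singleton.1 hA
  obtain ⟨hfI, hfB, hB⟩ := delta_eq_singleton.1 hB
  have hfA : ¬ Covers s(b, b') A := fun h => hne (hA _ hfI h).symm
  have heB : ¬ Covers e B := fun h => hne (hB _ heI h)
  obtain ⟨a, a', rfl, ha, ha'⟩ := heA
  have only : ∀ X, X = A ∩ B ∨ X = A ∪ B ∨ X = A \ B ∨ X = B \ A →
      ∀ g ∈ I, Covers g X → g = s(a, a') ∨ g = s(b, b') := by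
    intro X hX g hg hgX
    have : Covers g A ∨ Covers g B := by
      obtain ⟨u, v, rfl, hu, hv⟩ := hgX
      simp only [covers_mk]
      rcases hX with rfl | rfl | rfl | rfl <;>
        simp only [Set.mem_inter_iff, Set.mem_union, Set.mem_sdiff] at hu hv <;> tauto
    exact this.imp (hA g hg) (hB g hg)
  have cov : ∀ X, X = A ∩ B ∨ X = A ∪ B ∨ X = A \ B ∨ X = B \ A → X ∈ F →
      Covers s(a, a') X := by
    intro X hX hXF
    by_contra hc
    refine hmin X hX ⟨hXF, delta_eq_singleton.2 ⟨hfI, ?_, ?_⟩⟩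
    · obtain ⟨g, hg, hgX⟩ := hI.exists_covers hXF
      rcases only X hX g hg hgX with rfl | rfl
      · exact absurd hgX hc
      · exact hgX
    · intro g hg hgX
      rcases only X hX g hg hgX with rfl | rfl
      · exact absurd hgX hc
      · rfl
  have wit : ∀ X, X = A ∩ B ∨ X = A ∪ B ∨ X = A \ B ∨ X = B \ A → X ∈ F →
      ¬ Covers s(b, b') X → WitnessSet F I X s(a, a') := by
    intro X hX hXF hc
    refine ⟨hXF, delta_eq_singleton.2 ⟨heI, cov X hX hXF, ?_⟩⟩
    intro g hg hgX
    rcases only X hX g hg hgX with rfl | rfl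
    · rfl
    · exact absurd hgX hc
  have c1 := cov (A ∩ B) (by simp)
  have c2 := cov (A ∪ B) (by simp)
  have c3 := cov (A \ B) (by simp)
  have c4 := cov (B \ A) (by simp)
  have w1 := wit (A ∩ B) (by simp)
  have w2 := wit (A ∪ B) (by simp)
  have w3 := wit (A \ B) (by simp)
  have w4 := wit (B \ A) (by simp)
  have hp := hF A hAF B hBF
  clear only cov wit hmin hA hB
  simp only [covers_mk, Set.mem_inter_iff, Set.mem_union, Set.mem_sdiff, AtLeastTwo] at *
  by_cases haB : a ∈ B <;> by_cases hbA : b ∈ A <;> simp only [hbA, if_true, if_false] <;> grind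

/-- Every minimal cover of a pliable family has a laminar choice of witness sets. -/
lemma exists_laminar_witness [Finite V] {F : Set (Set V)} (hF : Pliable F)
    {I : Finset (Sym2 V)} (hI : MinimalCover I F) :
    ∃ W : Sym2 V → Set V, (∀ e ∈ I, WitnessSet F I (W e) e) ∧
      ∀ e ∈ I, ∀ f ∈ I, Nested (W e) (W f) := by
  suffices h : ∀ J ⊆ I, ∃ W : Sym2 V → Set V, (∀ e ∈ J, WitnessSet F I (W e) e) ∧
      ∀ e ∈ J, ∀ f ∈ J, Nested (W e) (W f) from h I subset_rfl
  intro J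
  induction J using Finset.induction_on with
  | empty => exact fun _ => ⟨fun _ => ∅, by simp, by simp⟩
  | insert f J hfJ ih =>
    intro hJ
    obtain ⟨hfI, hJI⟩ := Finset.insert_subset_iff.1 hJ
    obtain ⟨W, hW, hlam⟩ := ih hJI
    obtain ⟨B, hB, hBmin⟩ := Set.exists_min_image {S | WitnessSet F I S f}
      (fun S => (J.filter fun e => ¬ Nested S (W e)).card) (Set.toFinite _)
      (hI.exists_witnessSet hfI)
    obtain ⟨b, b', rfl, hb, hb'⟩ := (delta_eq_singleton.1 hB.2).2.1
    have key : ∀ e ∈ J, ∃ X, WitnessSet F I X e ∧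
        ((X = if b ∈ W e then W e ∪ B else W e \ B) ∨
          (X = if b ∈ W e then B \ W e else W e ∩ B)) := by
      intro e he
      have hne : e ≠ s(b, b') := fun h => hfJ (h ▸ he)
      have heW := hW e he
      have hfW : ¬ Covers s(b, b') (W e) := fun h =>
        hne ((delta_eq_singleton.1 heW.2).2.2 _ hfI h).symm
      rw [covers_mk] at hfW
      by_cases hn : Nested (W e) B
      · refine ⟨W e, heW, ?_⟩
        rcases hn with h | h | h
        · have hbW : b ∉ W e := fun h1 => hb' (h (by tauto))
          right
          simp [hbW, h]
        · left
          simp [h hb, Set.union_eq_self_of_subset_right h]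
        · have hbW : b ∉ W e := fun h1 => Set.disjoint_left.1 h h1 hb
          left
          simp [hbW, h.sdiff_eq_left]
      · have := exists_witness_uncrossed hF hI.1 heW hB hb hb' hne ?_
        · rcases this with h | h
          · exact ⟨_, h, Or.inl rfl⟩
          · exact ⟨_, h, Or.inr rfl⟩
        · intro X hX hXw
          refine absurd (hBmin X hXw) (not_le.2 (Finset.card_lt_card ?_))
          rw [Finset.ssubset_iff_of_subset]
          · refine ⟨e, Finset.mem_filter.2 ⟨he, fun h => hn h.symm⟩, ?_⟩
            simp only [Finset.mem_filter, not_and, not_not]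
            intro _
            rcases hX with rfl | rfl | rfl | rfl
            · exact Or.inl Set.inter_subset_left
            · exact Or.inr (Or.inl Set.subset_union_left)
            · exact Or.inl Set.sdiff_subset
            · exact Or.inr (Or.inr Set.disjoint_sdiff_left)
          · intro g hg
            rw [Finset.mem_filter] at hg ⊢
            refine ⟨hg.1, fun hBg => hg.2 ?_⟩
            obtain ⟨h1, h2, h3, h4⟩ := Nested.corners (hlam e he g hg.1) hBg hn
            rcases hX with rfl | rfl | rfl | rfl <;> assumption
    choose! T hT hTeq using key
    have hTB : ∀ e ∈ J, Nested (T e) B := by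
      intro e he
      have := hTeq e he
      simp only [Nested, Set.subset_def, Set.disjoint_left]
      by_cases h : b ∈ W e <;> simp only [h, if_true, if_false] at this <;>
        rcases this with h | h <;>
        simp only [h, Set.mem_union, Set.mem_inter_iff, Set.mem_sdiff] <;>
        grind
    have hTT : ∀ e ∈ J, ∀ g ∈ J, Nested (T e) (T g) := by
      intro e he g hg
      have h1 := hTeq e he
      have h2 := hTeq g hg
      have h3 := hlam e he g hg
      simp only [Nested, Set.subset_def, Set.disjoint_left] at h3 ⊢
      by_cases hbe : b ∈ W e <;> by_cases hbg : b ∈ W g <;>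
        simp only [hbe, hbg, if_true, if_false] at h1 h2 <;>
        rcases h1 with h1 | h1 <;> rcases h2 with h2 | h2 <;>
        simp only [h1, h2, Set.mem_union, Set.mem_inter_iff, Set.mem_sdiff] <;>
        clear h1 h2 <;> grind
    refine ⟨fun e => if e = s(b, b') then B else T e, ?_, ?_⟩
    · intro e he
      by_cases h : e = s(b, b')
      · subst h
        simpa using hB
      · simpa [h] using hT e (Finset.mem_of_mem_insert_of_ne he h)
    · intro e he g hg
      by_cases h : e = s(b, b') <;> by_cases h' : g = s(b, b') <;>
        simp only [h, h', if_true, if_false]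
      · exact Or.inl subset_rfl
      · exact (hTB g (Finset.mem_of_mem_insert_of_ne hg h')).symm
      · exact hTB e (Finset.mem_of_mem_insert_of_ne he h)
      · exact hTT e (Finset.mem_of_mem_insert_of_ne he h) g (Finset.mem_of_mem_insert_of_ne hg h')

lemma Core.eq_of_mem {F : Set (Set V)} (hF : Pliable F) {C D : Set V}
    (hC : Core F C) (hD : Core F D) {x : V} (hxC : x ∈ C) (hxD : x ∈ D) : C = D := by
  have h1 : C ∩ D ∈ F → C = D := fun h =>
    (hC.2 _ h Set.inter_subset_left).symm.trans (hD.2 _ h Set.inter_subset_right)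
  have h2 : C \ D ∉ F := fun h => by
    have := hC.2 _ h Set.sdiff_subset
    rw [← this] at hxC
    exact hxC.2 hxD
  have h3 : D \ C ∉ F := fun h => by
    have := hD.2 _ h Set.sdiff_subset
    rw [← this] at hxD
    exact hxD.2 hxC
  have := hF C hC.1 D hD.1
  simp only [AtLeastTwo] at this
  tauto

lemma Core.nonempty {F : Set (Set V)} (h0 : ∅ ∉ F) {C : Set V} (hC : Core F C) : C.Nonempty :=
  Set.nonempty_iff_ne_empty.2 fun h => h0 (h ▸ hC.1)

lemma exists_core_subset [Finite V] {F : Set (Set V)} {S : Set V} (hS : S ∈ F) :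
    ∃ C, Core F C ∧ C ⊆ S := by
  obtain ⟨C, hCS, hC⟩ := (Set.toFinite F).exists_le_minimal hS
  exact ⟨C, ⟨hC.prop, fun A hA hAC => hAC.antisymm (hC.le_of_le hA hAC)⟩, hCS⟩

lemma Core.crosses {F : Set (Set V)} (hF : IsSetFamily F) (hp : Pliable F) {C S : Set V}
    (hC : Core F C) (hS : S ∈ F) (hCS : (C ∩ S).Nonempty) (hsub : ¬ C ⊆ S) : Crosses C S := by
  obtain ⟨x, hx⟩ := hCS
  refine ⟨⟨x, hx⟩, Set.sdiff_nonempty.2 hsub, Set.sdiff_nonempty.2 fun h => ?_, ?_⟩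
  · exact hsub (hC.2 S hS h).ge
  · rw [Set.nonempty_compl]
    intro hu
    have h1 : C ∩ S ∉ F := fun h => hsub (Set.inter_eq_left.1 (hC.2 _ h Set.inter_subset_left))
    have h2 : C \ S ∉ F := fun h => by
      have := hC.2 _ h Set.sdiff_subset
      rw [← this] at hx
      exact hx.1.2 hx.2
    have h3 : C ∪ S ∉ F := hu ▸ hF.2
    have := hp C hC.1 S hS
    simp only [AtLeastTwo] at this
    tauto

/-- `A ⊂ S` and every `F`-core inside `S` already lies in `A`. -/
def CoreFreeStep (F : Set (Set V)) (A S : Set V) : Prop :=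
  A ⊂ S ∧ ∀ C, Core F C → C ⊆ S → C ⊆ A

lemma CoreFreeStep.trans {F : Set (Set V)} {A S T : Set V} (h₁ : CoreFreeStep F A S)
    (h₂ : CoreFreeStep F S T) : CoreFreeStep F A T :=
  ⟨h₁.1.trans h₂.1, fun C hC hCT => h₁.2 C hC (h₂.2 C hC hCT)⟩

lemma CoreFreeStep.sdiff_subset [Finite V] {F : Set (Set V)} (hF : IsSetFamily F)
    (hgp : GammaPliable F) {A S C : Set V} (hA : A ∈ F) (hS : S ∈ F) (h : CoreFreeStep F A S)
    (hC : Core F C) (hCA : (C ∩ A).Nonempty) (hsub : ¬ C ⊆ A) : S \ A ⊆ C := by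
  have hres : Residual F ∅ = F := by
    ext X
    simp [Residual, d, delta]
  have hγ := hgp.2 ∅ A S C
  rw [hres] at hγ
  have hCS : (C ∩ S).Nonempty := hCA.mono (Set.inter_subset_inter_right _ h.1.1)
  rcases hγ hA hS h.1 hC (hC.crosses hF hgp.1 hA hCA hsub)
    (hC.crosses hF hgp.1 hS hCS fun hs => hsub (h.2 C hC hs)) with h0 | h0
  · intro x hx
    by_contra hxC
    exact (h0 ▸ (⟨hx.1, by simp [hx.2, hxC]⟩ : x ∈ S \ (A ∪ C)) : x ∈ (∅ : Set V))
  · obtain ⟨D, hD, hDS⟩ := exists_core_subset h0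
    obtain ⟨x, hx⟩ := hD.nonempty hF.1
    exact absurd (h.2 D hD (hDS.trans Set.sdiff_subset) hx) fun hxA => (hDS hx).2 (Or.inl hxA)

/-- The number of `F`-cores covered by the edge `e`. -/
noncomputable def coreDegree (F : Set (Set V)) (e : Sym2 V) : ℕ :=
  {C | Core F C ∧ Covers e C}.ncard

lemma coreDegree_le_two {F : Set (Set V)} (hp : Pliable F) (e : Sym2 V) :
    coreDegree F e ≤ 2 := by
  induction e using Sym2.ind with
  | _ x y =>
  have key : ∀ z, {C | Core F C ∧ z ∈ C}.Subsingleton := fun z C hC D hD =>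
    hC.1.eq_of_mem hp hD.1 hC.2 hD.2
  have hsub : {C | Core F C ∧ Covers s(x, y) C} ⊆
      {C | Core F C ∧ x ∈ C} ∪ {C | Core F C ∧ y ∈ C} := by
    rintro C ⟨hC, hc⟩
    rw [covers_mk] at hc
    simp only [Set.mem_union, Set.mem_ofPred_eq]
    tauto
  calc _ ≤ _ := Set.ncard_le_ncard hsub ((key x).finite.union (key y).finite)
    _ ≤ _ := Set.ncard_union_le _ _
    _ ≤ 1 + 1 := add_le_add ((Set.ncard_le_one (key x).finite).2 fun _ h _ h' => key x h h')
      ((Set.ncard_le_one (key y).finite).2 fun _ h _ h' => key y h h')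

lemma coreDegree_le_one {F : Set (Set V)} (hp : Pliable F) {x y : V}
    (h : ∀ C D, Core F C → Core F D → x ∈ C → y ∈ D → C = D) : coreDegree F s(x, y) ≤ 1 := by
  have hs : {C | Core F C ∧ Covers s(x, y) C}.Subsingleton := by
    rintro C ⟨hC, hCc⟩ D ⟨hD, hDc⟩
    rw [covers_mk] at hCc hDc
    rcases hCc with hCc | hCc <;> rcases hDc with hDc | hDc
    · exact hC.eq_of_mem hp hD hCc.1 hDc.1
    · exact h C D hC hD hCc.1 hDc.1
    · exact (h D C hD hC hDc.1 hCc.1).symm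
    · exact hC.eq_of_mem hp hD hCc.1 hDc.1
  exact (Set.ncard_le_one hs.finite).2 fun _ h _ h' => hs h h'

/-- The edge `s(x, y)` of `I` leaves its witness set `S` from `x` to `y`. -/
structure Leaves (F : Set (Set V)) (I : Finset (Sym2 V)) (S : Set V) (x y : V) : Prop where
  witness : WitnessSet F I S s(x, y)
  left_mem : x ∈ S
  right_notMem : y ∉ S

lemma WitnessSet.exists_leaves {F : Set (Set V)} {I : Finset (Sym2 V)} {S : Set V} {e : Sym2 V}
    (h : WitnessSet F I S e) : ∃ x y, e = s(x, y) ∧ Leaves F I S x y := by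
  obtain ⟨x, y, rfl, hx, hy⟩ := (delta_eq_singleton.1 h.2).2.1
  exact ⟨x, y, rfl, h, hx, hy⟩

lemma Leaves.mem_mem {F : Set (Set V)} {I : Finset (Sym2 V)} {A S : Set V} {x y u v : V}
    (hA : Leaves F I A x y) (hS : Leaves F I S u v) (hAS : A ⊆ S) (hne : s(x, y) ≠ s(u, v)) :
    y ∈ S ∧ u ∉ A := by
  have h1 := delta_eq_singleton.1 hA.witness.2
  have h2 := delta_eq_singleton.1 hS.witness.2
  constructor
  · by_contra h
    exact hne (h2.2.2 _ h1.1 (covers_mk.2 (Or.inl ⟨hAS hA.left_mem, h⟩)))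
  · intro h
    exact hne (h1.2.2 _ h2.1
      (covers_mk.2 (Or.inl ⟨h, fun hv => hS.right_notMem (hAS hv)⟩))).symm

section Overlap

variable [Finite V] {F : Set (Set V)} {I : Finset (Sym2 V)}

lemma CoreFreeStep.false_of_core_overlap (hF : IsSetFamily F) (hgp : GammaPliable F)
    (hcov : ∀ e ∈ I, ∃ C : Set V, Core F C ∧ Covers e C) {A S T : Set V} {u v p q : V}
    (hA : A ∈ F) (hS : Leaves F I S u v) (hT : Leaves F I T p q) (hST : s(u, v) ≠ s(p, q))
    (hu : u ∉ A) (h₁ : CoreFreeStep F A S) (h₂ : CoreFreeStep F S T)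
    {C : Set V} (hC : Core F C) (hCA : (C ∩ A).Nonempty) (hsub : ¬ C ⊆ A) : False := by
  have hTA := (h₁.trans h₂).sdiff_subset hF hgp hA hT.witness.1 hC hCA hsub
  have hv := (hS.mem_mem hT h₂.1.1 hST).1
  have huC : u ∈ C := hTA ⟨h₂.1.1 hS.left_mem, hu⟩
  have hvC : v ∈ C := hTA ⟨hv, fun h => hS.right_notMem (h₁.1.1 h)⟩
  obtain ⟨D, hD, hDc⟩ := hcov s(u, v) (delta_eq_singleton.1 hS.witness.2).1
  rw [covers_mk] at hDc
  rcases hDc with h | h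
  · have := hC.eq_of_mem hgp.1 hD huC h.1
    exact h.2 (this ▸ hvC)
  · have := hC.eq_of_mem hgp.1 hD hvC h.1
    exact h.2 (this ▸ huC)

lemma CoreFreeStep.coreDegree_le_one (hF : IsSetFamily F) (hgp : GammaPliable F)
    {A S T : Set V} {u v p q : V}
    (hS : Leaves F I S u v) (hT : Leaves F I T p q) (hST : s(u, v) ≠ s(p, q))
    (hu : u ∉ A) (h₁ : CoreFreeStep F A S) (h₂ : CoreFreeStep F S T) :
    coreDegree F s(u, v) ≤ 1 := by
  refine SFEC.coreDegree_le_one hgp.1 fun C D hC hD huC hvD => ?_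
  have hvC : v ∈ C := h₂.sdiff_subset hF hgp hS.witness.1 hT.witness.1 hC ⟨u, huC, hS.left_mem⟩
    (fun h => hu (h₁.2 C hC h huC)) ⟨(hS.mem_mem hT h₂.1.1 hST).1, hS.right_notMem⟩
  exact hC.eq_of_mem hgp.1 hD hvC hvD

end Overlap

section Counting

variable {L 𝒞 : Finset (Set V)} {c : Set V → ℕ}

/-- Summing a bound for each maximal member of a laminar family. -/
lemma exists_maximal_sum_le (hlam : ∀ A ∈ L, ∀ B ∈ L, Nested A B)
    (hne : ∀ C ∈ 𝒞, C.Nonempty) (hL : ∀ S ∈ L, ∃ C ∈ 𝒞, C ⊆ S)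
    (hb : ∀ S ∈ L, ∑ T ∈ L with T ⊆ S, c T + 5 ≤ 10 * {C ∈ 𝒞 | C ⊆ S}.card) :
    ∃ M ⊆ L, (∀ T ∈ L, ∃ m ∈ M, T ⊆ m) ∧
      ∑ T ∈ L, c T + 5 * M.card ≤ 10 * {C ∈ 𝒞 | ∃ m ∈ M, C ⊆ m}.card := by
  set M := L.filter (Maximal (· ∈ L)) with hM
  have hML : M ⊆ L := Finset.filter_subset _ _
  have hcov : ∀ T ∈ L, ∃ m ∈ M, T ⊆ m := by
    intro T hT
    obtain ⟨m, hTm, hm⟩ := L.finite_toSet.exists_le_maximal hT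
    exact ⟨m, Finset.mem_filter.2 ⟨hm.prop, hm⟩, hTm⟩
  have hdisj : ∀ m ∈ M, ∀ m' ∈ M, m ≠ m' → Disjoint m m' := by
    intro m hm m' hm' hmm
    obtain ⟨hmL, hmax⟩ := Finset.mem_filter.1 hm
    obtain ⟨hmL', hmax'⟩ := Finset.mem_filter.1 hm'
    rcases hlam m hmL m' hmL' with h | h | h
    · exact absurd (hmax.eq_of_le hmL' h) hmm
    · exact absurd (hmax'.eq_of_le hmL h).symm hmm
    · exact h
  have hneL : ∀ S ∈ L, S.Nonempty := fun S hS => by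
    obtain ⟨C, hC, hCS⟩ := hL S hS
    exact (hne C hC).mono hCS
  have hpart : ∀ X : Finset (Set V), (∀ T ∈ X, T.Nonempty) →
      (M : Set (Set V)).PairwiseDisjoint fun m => X.filter (· ⊆ m) := by
    intro X hX m hm m' hm' hmm
    refine Finset.disjoint_left.2 fun T hT hT' => ?_
    rw [Finset.mem_filter] at hT hT'
    obtain ⟨x, hx⟩ := hX T hT.1
    exact Set.disjoint_left.1 (hdisj m hm m' hm' hmm) (hT.2 hx) (hT'.2 hx)
  have h1 : ∑ T ∈ L, c T = ∑ m ∈ M, ∑ T ∈ L with T ⊆ m, c T := by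
    rw [← Finset.sum_biUnion (hpart L hneL)]
    refine Finset.sum_congr ?_ fun _ _ => rfl
    ext T
    simp only [Finset.mem_biUnion, Finset.mem_filter]
    exact ⟨fun hT => (hcov T hT).imp fun m hm => ⟨hm.1, hT, hm.2⟩, fun ⟨_, _, hT, _⟩ => hT⟩
  have h2 : {C ∈ 𝒞 | ∃ m ∈ M, C ⊆ m}.card = ∑ m ∈ M, {C ∈ 𝒞 | C ⊆ m}.card := by
    rw [← Finset.card_biUnion (hpart 𝒞 hne)]
    congr 1
    ext C
    simp only [Finset.mem_biUnion, Finset.mem_filter]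
    exact ⟨fun ⟨hC, m, hm, hCm⟩ => ⟨m, hm, hC, hCm⟩, fun ⟨m, hm, hC, hCm⟩ => ⟨hC, m, hm, hCm⟩⟩
  refine ⟨M, hML, hcov, ?_⟩
  rw [h1, h2, Finset.mul_sum, mul_comm, ← smul_eq_mul, ← Finset.sum_const,
    ← Finset.sum_add_distrib]
  exact Finset.sum_le_sum fun m hm => hb m (hML hm)

lemma sum_subset_eq_add {S : Set V} (hS : S ∈ L) :
    ∑ T ∈ L with T ⊆ S, c T = c S + ∑ T ∈ L with T ⊂ S, c T := by
  rw [← Finset.sum_insert (by simp)]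
  refine Finset.sum_congr ?_ fun _ _ => rfl
  ext T
  simp only [Finset.mem_insert, Finset.mem_filter]
  constructor
  · rintro ⟨hT, hTS⟩
    exact (eq_or_ssubset_of_subset hTS).imp id fun h => ⟨hT, h⟩
  · rintro (rfl | ⟨hT, hTS⟩)
    · exact ⟨hS, subset_rfl⟩
    · exact ⟨hT, hTS.1⟩

/-- `A` is the unique child of `S` in `L`, and every member of `𝒞` inside `S` lies in `A`. -/
def Link (L 𝒞 : Finset (Set V)) (A S : Set V) : Prop :=
  A ∈ L ∧ S ∈ L ∧ A ⊂ S ∧ (∀ T ∈ L, T ⊂ S → T ⊆ A) ∧ ∀ C ∈ 𝒞, C ⊆ S → C ⊆ A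

lemma Link.sum_eq {A S : Set V} (h : Link L 𝒞 A S) :
    ∑ T ∈ L with T ⊆ S, c T = c S + ∑ T ∈ L with T ⊆ A, c T := by
  rw [sum_subset_eq_add h.2.1]
  congr 1
  refine Finset.sum_congr (Finset.filter_congr fun T hT => ?_) fun _ _ => rfl
  exact ⟨h.2.2.2.1 T hT, fun hTA => hTA.trans_ssubset h.2.2.1⟩

lemma Link.card_eq {A S : Set V} (h : Link L 𝒞 A S) :
    {C ∈ 𝒞 | C ⊆ S}.card = {C ∈ 𝒞 | C ⊆ A}.card := by
  congr 1
  refine Finset.filter_congr fun C hC => ?_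
  exact ⟨h.2.2.2.2 C hC, fun hCA => hCA.trans h.2.2.1.1⟩

lemma sum_subset_le_of_not_link (hlam : ∀ A ∈ L, ∀ B ∈ L, Nested A B)
    (hne : ∀ C ∈ 𝒞, C.Nonempty) (hL : ∀ S ∈ L, ∃ C ∈ 𝒞, C ⊆ S) {S : Set V} (hS : S ∈ L)
    (hlink : ∀ A, ¬ Link L 𝒞 A S)
    (hb : ∀ A ∈ L, A ⊂ S → ∑ T ∈ L with T ⊆ A, c T + 5 ≤ 10 * {C ∈ 𝒞 | C ⊆ A}.card) :
    ∑ T ∈ L with T ⊆ S, c T + 10 ≤ 10 * {C ∈ 𝒞 | C ⊆ S}.card + c S := by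
  rw [sum_subset_eq_add hS]
  have hX : ∀ A ∈ {T ∈ L | T ⊂ S}, A ∈ L ∧ A ⊂ S := fun A hA => Finset.mem_filter.1 hA
  obtain ⟨M, hM, hcov, hsum⟩ := exists_maximal_sum_le (L := {T ∈ L | T ⊂ S}) (𝒞 := 𝒞) (c := c)
    (fun A hA B hB => hlam A (hX A hA).1 B (hX B hB).1) hne (fun A hA => hL A (hX A hA).1)
    (fun A hA => by
      rw [Finset.filter_filter]
      convert hb A (hX A hA).1 (hX A hA).2 using 5
      exact ⟨fun h => h.2, fun h => ⟨h.trans_ssubset (hX A hA).2, h⟩⟩)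
  have hsub : {C ∈ 𝒞 | ∃ m ∈ M, C ⊆ m} ⊆ {C ∈ 𝒞 | C ⊆ S} := by
    intro C hC
    rw [Finset.mem_filter] at hC ⊢
    obtain ⟨hC, m, hm, hCm⟩ := hC
    exact ⟨hC, hCm.trans (hX m (hM hm)).2.1⟩
  have hle := Finset.card_le_card hsub
  rcases Nat.lt_trichotomy M.card 1 with h | h | h
  · obtain rfl : M = ∅ := Finset.card_eq_zero.1 (by omega)
    obtain ⟨C, hC, hCS⟩ := hL S hS
    have : 0 < {C ∈ 𝒞 | C ⊆ S}.card := Finset.card_pos.2 ⟨C, Finset.mem_filter.2 ⟨hC, hCS⟩⟩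
    simp only [Finset.card_empty, Finset.notMem_empty, false_and, exists_false,
      Finset.filter_false] at hsum
    omega
  · obtain ⟨A, rfl⟩ := Finset.card_eq_one.1 h
    obtain ⟨hAL, hAS⟩ := hX A (hM (Finset.mem_singleton_self A))
    have : {C ∈ 𝒞 | ∃ m ∈ ({A} : Finset (Set V)), C ⊆ m}.card < {C ∈ 𝒞 | C ⊆ S}.card := by
      refine Finset.card_lt_card ((Finset.ssubset_iff_of_subset hsub).2 ?_)
      by_contra! hall
      refine hlink A ⟨hAL, hS, hAS, fun T hT hTS => ?_, fun C hC hCS => ?_⟩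
      · simpa using hcov T (Finset.mem_filter.2 ⟨hT, hTS⟩)
      · simpa [hC] using hall C (Finset.mem_filter.2 ⟨hC, hCS⟩)
    omega
  · omega

/-- If chains of links have length at most three and carry total weight at most five, then a
laminar family has total weight at most `5 * (2 * |𝒞| - 1)`. -/
lemma sum_le_of_links (hlam : ∀ A ∈ L, ∀ B ∈ L, Nested A B)
    (hne : ∀ C ∈ 𝒞, C.Nonempty) (hL : ∀ S ∈ L, ∃ C ∈ 𝒞, C ⊆ S) (hc : ∀ S ∈ L, c S ≤ 2)
    (h₂ : ∀ A B C, Link L 𝒞 A B → Link L 𝒞 B C → c B ≤ 1)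
    (h₃ : ∀ A B C D, Link L 𝒞 A B → Link L 𝒞 B C → Link L 𝒞 C D → c A ≤ 1)
    (h₄ : ∀ A B C D E, Link L 𝒞 A B → Link L 𝒞 B C → Link L 𝒞 C D → ¬ Link L 𝒞 D E) :
    ∑ S ∈ L, c S ≤ 5 * (2 * 𝒞.card - 1) := by
  have main : ∀ S ∈ L, ∑ T ∈ L with T ⊆ S, c T + 5 ≤ 10 * {C ∈ 𝒞 | C ⊆ S}.card := by
    suffices h : ∀ n, ∀ S ∈ L, {T ∈ L | T ⊂ S}.card = n →
        ∑ T ∈ L with T ⊆ S, c T + 5 ≤ 10 * {C ∈ 𝒞 | C ⊆ S}.card from fun S hS => h _ S hS rfl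
    intro n
    induction n using Nat.strong_induction_on with
    | _ n ih =>
    rintro S hS rfl
    have ih' : ∀ A ∈ L, A ⊂ S →
        ∑ T ∈ L with T ⊆ A, c T + 5 ≤ 10 * {C ∈ 𝒞 | C ⊆ A}.card := by
      intro A hA hAS
      refine ih _ (Finset.card_lt_card ?_) A hA rfl
      refine (Finset.ssubset_iff_of_subset fun T hT => ?_).2
        ⟨A, Finset.mem_filter.2 ⟨hA, hAS⟩, by simp⟩
      rw [Finset.mem_filter] at hT ⊢
      exact ⟨hT.1, hT.2.trans hAS⟩
    have base : ∀ A ∈ L, A ⊆ S → (∀ B, ¬ Link L 𝒞 B A) →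
        ∑ T ∈ L with T ⊆ A, c T + 10 ≤ 10 * {C ∈ 𝒞 | C ⊆ A}.card + c A :=
      fun A hA hAS hB => sum_subset_le_of_not_link hlam hne hL hA hB fun T hT hTA =>
        ih' T hT (hTA.trans_subset hAS)
    have hcS := hc S hS
    by_cases hD : ∃ D, Link L 𝒞 D S
    · obtain ⟨D, hD⟩ := hD
      have hcD := hc D hD.1
      have hDS := hD.2.2.1.1
      rw [hD.sum_eq, hD.card_eq]
      by_cases hC : ∃ C, Link L 𝒞 C D
      · obtain ⟨C, hC⟩ := hC
        have hcC := hc C hC.1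
        have hCS := hC.2.2.1.1.trans hDS
        have hD1 := h₂ _ _ _ hC hD
        rw [hC.sum_eq, hC.card_eq]
        by_cases hB : ∃ B, Link L 𝒞 B C
        · obtain ⟨B, hB⟩ := hB
          have hC1 := h₂ _ _ _ hB hC
          have hB1 := h₃ _ _ _ _ hB hC hD
          have := base B hB.1 (hB.2.2.1.1.trans hCS) fun A hA => h₄ _ _ _ _ _ hA hB hC hD
          rw [hB.sum_eq, hB.card_eq]
          omega
        · have := base C hC.1 hCS (not_exists.1 hB)
          omega
      · have := base D hD.1 hDS (not_exists.1 hC)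
        omega
    · have := base S hS subset_rfl (not_exists.1 hD)
      omega
  obtain ⟨M, hM, hcov, hsum⟩ := exists_maximal_sum_le hlam hne hL main
  have hle := Finset.card_le_card (Finset.filter_subset (fun C => ∃ m ∈ M, C ⊆ m) 𝒞)
  rcases L.eq_empty_or_nonempty with rfl | ⟨S, hS⟩
  · simp
  · obtain ⟨m, hm, -⟩ := hcov S hS
    have := Finset.card_pos.2 ⟨m, hm⟩
    omega

end Counting

end SFEC

theorem stmt_17 {V : Type*} [Fintype V]
    (F : Set (Set V)) (hF : IsSetFamily F) (hgp : GammaPliable F)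
    (I : Finset (Sym2 V)) (hIe : ∀ e ∈ I, ¬ e.IsDiag)
    (hmin : MinimalCover I F)
    (hcov : ∀ e ∈ I, ∃ C : Set V, Core F C ∧ Covers e C) :
    ∑ C ∈ (Set.toFinite {C : Set V | Core F C}).toFinset, d I C ≤
      5 * (2 * {C : Set V | Core F C}.ncard - 1) := by
  set 𝒞 := (Set.toFinite {C : Set V | Core F C}).toFinset with h𝒞
  have mem𝒞 : ∀ C, C ∈ 𝒞 ↔ Core F C := fun C => by simp [h𝒞]
  rcases I.eq_empty_or_nonempty with rfl | ⟨e₀, he₀⟩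
  · simp [d, delta]
  have : Nonempty (Sym2 V) := ⟨e₀⟩
  have : Nonempty V := ⟨e₀.out.1⟩
  obtain ⟨W, hW, hlam⟩ := exists_laminar_witness hgp.1 hmin
  have hinj : Set.InjOn W I := fun e he f hf hef => by
    have h := (hW e he).2
    rw [hef, (hW f hf).2] at h
    exact (Finset.singleton_injective h).symm
  have hsum : ∑ C ∈ 𝒞, d I C = ∑ e ∈ I, coreDegree F e := by
    simp only [d, delta, Finset.card_filter]
    rw [Finset.sum_comm]
    refine Finset.sum_congr rfl fun e _ => ?_
    rw [← Finset.card_filter, coreDegree, ← Set.ncard_coe_finset]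
    congr 1
    ext C
    simp [mem𝒞]
  choose! ε hε using fun S (hS : S ∈ I.image W) => Finset.mem_image.1 hS
  have hεW : ∀ e ∈ I, ε (W e) = e := fun e he =>
    hinj (hε _ (Finset.mem_image_of_mem W he)).1 he (hε _ (Finset.mem_image_of_mem W he)).2
  have hsum' : ∑ e ∈ I, coreDegree F e = ∑ S ∈ I.image W, coreDegree F (ε S) := by
    rw [Finset.sum_image hinj]
    exact Finset.sum_congr rfl fun e he => by rw [hεW e he]
  have hwit : ∀ S ∈ I.image W, ∃ x y, ε S = s(x, y) ∧ Leaves F I S x y := by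
    intro S hS
    have := hW _ (hε S hS).1
    rw [(hε S hS).2] at this
    exact this.exists_leaves
  choose! x y hxy hleaves using hwit
  have hstep : ∀ {A S}, Link (I.image W) 𝒞 A S → CoreFreeStep F A S := fun h =>
    ⟨h.2.2.1, fun C hC => h.2.2.2.2 C ((mem𝒞 C).2 hC)⟩
  have hsep : ∀ {A S}, Link (I.image W) 𝒞 A S → s(x A, y A) ≠ s(x S, y S) := by
    intro A S h heq
    rw [← hxy A h.1, ← hxy S h.2.1] at heq
    apply h.2.2.1.ne
    rw [← (hε A h.1).2, heq, (hε S h.2.1).2]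
  have hmem : ∀ {A S}, Link (I.image W) 𝒞 A S → y A ∈ S ∧ x S ∉ A := fun {A S} h =>
    (hleaves A h.1).mem_mem (hleaves S h.2.1) h.2.2.1.1 (hsep h)
  have hoverlap : ∀ {A S T C z}, Link (I.image W) 𝒞 A S → Link (I.image W) 𝒞 S T → Core F C →
      z ∈ C → z ∈ A → ¬ C ⊆ A → False := fun {A S T C z} h₁ h₂ hC hzC hzA hCA =>
    CoreFreeStep.false_of_core_overlap hF hgp hcov (hleaves A h₁.1).witness.1
      (hleaves S h₁.2.1) (hleaves T h₂.2.1) (hsep h₂) (hmem h₁).2 (hstep h₁) (hstep h₂) hC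
      ⟨z, hzC, hzA⟩ hCA
  rw [hsum, hsum', Set.ncard_eq_toFinset_card _ (Set.toFinite {C : Set V | Core F C})]
  refine sum_le_of_links (𝒞 := 𝒞) ?_ (fun C hC => ((mem𝒞 C).1 hC).nonempty hF.1) ?_
    (fun S _ => coreDegree_le_two hgp.1 _) ?_ ?_ ?_
  · intro A hA B hB
    rw [← (hε A hA).2, ← (hε B hB).2]
    exact hlam _ (hε A hA).1 _ (hε B hB).1
  · intro S hS
    obtain ⟨C, hC, hCS⟩ := exists_core_subset (hleaves S hS).witness.1
    exact ⟨C, (mem𝒞 C).2 hC, hCS⟩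
  · intro A S T h₁ h₂
    rw [hxy S h₁.2.1]
    exact CoreFreeStep.coreDegree_le_one hF hgp (hleaves S h₁.2.1) (hleaves T h₂.2.1) (hsep h₂)
      (hmem h₁).2 (hstep h₁) (hstep h₂)
  · intro S₀ S₁ S₂ S₃ h₁ h₂ h₃
    rw [hxy S₀ h₁.1]
    refine coreDegree_le_one hgp.1 fun _ C _ hC _ hyC => False.elim ?_
    exact hoverlap h₂ h₃ hC hyC (hmem h₁).1 fun h =>
      (hleaves S₀ h₁.1).right_notMem ((hstep h₁).2 C hC h hyC)
  · intro S₀ S₁ S₂ S₃ S₄ h₁ h₂ h₃ h₄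
    have hl := hleaves S₁ h₁.2.1
    obtain ⟨C, hC, hc⟩ := hcov _ (delta_eq_singleton.1 hl.witness.2).1
    rw [covers_mk] at hc
    rcases hc with hc | hc
    · exact hoverlap h₂ h₃ hC hc.1 hl.left_mem fun h => (hmem h₁).2 ((hstep h₁).2 C hC h hc.1)
    · exact hoverlap h₃ h₄ hC hc.1 (hmem h₂).1 fun h => hl.right_notMem ((hstep h₂).2 C hC h hc.1)
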